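/- Let f ≥ 1 and work in S_{2f}. Then 𝔻_{(1,f−1)} · H_f(2f) = H_{f−1}^{{3,…,2f}} · D_{(2,2f−2)} as subsets of S_{2f}; moreover every element of this set factors uniquely as u·v with u ∈ H_{f−1}^{{3,…,2f}} and v ∈ D_{(2,2f−2)}, and then ℓ(uv) = ℓ(u) + ℓ(v). Equivalently, this set equals the set of d in the minimal-length coset representatives D_{(2,2,…,2)} (f twos) with (3)d < (5)d < ⋯ < (2f−1)d. -/

import Mathlib

open Finset
open scoped Pointwise

namespace BMWPaper

/-- The Coxeter length of a permutation of `Fin n`: the number of inversions. -/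
def len {n : ℕ} (w : Equiv.Perm (Fin n)) : ℕ :=
  (Finset.univ.filter (fun p : Fin n × Fin n => p.1 < p.2 ∧ w p.2 < w p.1)).card

/-- `sGen n i` is the adjacent transposition `s_i = (i, i+1)` (1-based) in `S_n`;
it is the identity for out-of-range `i`. -/
def sGen (n i : ℕ) : Equiv.Perm (Fin n) :=
  if h : 1 ≤ i ∧ i < n then Equiv.swap ⟨i - 1, by omega⟩ ⟨i, h.2⟩ else 1

/-- `pimg d i` is the (1-based) image `(i)d` of the point `i ∈ {1,…,n}` under the
*right* action of the permutation `d` (permutations act on points on the right,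
so that `(a)(στ) = ((a)σ)τ` for the group multiplication `σ * τ`);
the junk value `0` is returned for out-of-range `i`. -/
def pimg {n : ℕ} (d : Equiv.Perm (Fin n)) (i : ℕ) : ℕ :=
  if h : i - 1 < n then ((d⁻¹ ⟨i - 1, h⟩ : Fin n) : ℕ) + 1 else 0

open scoped Classical in
/-- `Hset n f` is the set `H_f(n)` of all `d ∈ S_n` such that
`(1)d < (3)d < ⋯ < (2f-1)d`, `(2i-1)d < (2i)d` for `i = 1,…,f`, and
`(2f+1)d < (2f+2)d < ⋯ < (n)d`. -/
noncomputable def Hset (n f : ℕ) : Finset (Equiv.Perm (Fin n)) :=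
  Finset.univ.filter (fun d =>
    (∀ i ∈ Finset.Icc 1 (f - 1), pimg d (2 * i - 1) < pimg d (2 * i + 1)) ∧
    (∀ i ∈ Finset.Icc 1 f, pimg d (2 * i - 1) < pimg d (2 * i)) ∧
    (∀ j ∈ Finset.Icc (2 * f + 1) (n - 1), pimg d j < pimg d (j + 1)))

/-- The index of the block of the composition `μ` containing the (0-based) point `k`. -/
def blockOf (μ : List ℕ) (k : ℕ) : ℕ :=
  ((List.range μ.length).filter (fun j => (μ.take (j + 1)).sum ≤ k)).length

open scoped Classical in
/-- The Young subgroup `S_μ` of `S_n` associated with a composition `μ` of `n`,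
as the set of permutations preserving each of the consecutive blocks of `μ`. -/
noncomputable def youngSet (n : ℕ) (μ : List ℕ) : Finset (Equiv.Perm (Fin n)) :=
  Finset.univ.filter (fun w => ∀ a : Fin n, blockOf μ ((w a : ℕ)) = blockOf μ (a : ℕ))

open scoped Classical in
/-- The set `D_μ` of minimal-length right coset representatives of `S_μ` in `S_n`:
the elements of minimal length in their right coset `S_μ d`. -/
noncomputable def Dset (n : ℕ) (μ : List ℕ) : Finset (Equiv.Perm (Fin n)) :=
  Finset.univ.filter (fun d => ∀ u ∈ youngSet n μ, len d ≤ len (u * d))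

/-- The identification of `Fin m` with the block `[k, k+m)` of `Fin n` (0-based). -/
def shiftEquiv (n k m : ℕ) (h : k + m ≤ n) :
    Fin m ≃ {a : Fin n // k ≤ (a : ℕ) ∧ (a : ℕ) < k + m} where
  toFun b := ⟨⟨k + (b : ℕ), by have := b.isLt; omega⟩, by
    constructor
    · exact Nat.le_add_right _ _
    · have := b.isLt; simp only [Fin.val_mk]; omega⟩
  invFun a := ⟨(a : Fin n) - k, by have := a.2; omega⟩
  left_inv b := by
    apply Fin.ext
    simp
  right_inv a := by
    apply Subtype.ext
    apply Fin.ext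
    have := a.2
    simp only []
    omega

open scoped Classical in
/-- The embedding of `S_m` into `S_n` as the group of permutations of the
(1-based) block `{k+1, …, k+m}` of `{1, …, n}`. -/
noncomputable def shiftEmb (n k m : ℕ) (w : Equiv.Perm (Fin m)) : Equiv.Perm (Fin n) :=
  if h : k + m ≤ n then w.extendDomain (shiftEquiv n k m h) else 1

open scoped Classical in
/-- The subgroup of `S_n` of permutations fixing the (1-based) points `1, …, k`. -/
noncomputable def fixSet (n k : ℕ) : Finset (Equiv.Perm (Fin n)) :=
  Finset.univ.filter (fun w => ∀ a : Fin n, (a : ℕ) < k → w a = a)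


/-- `bbs n i` is the permutation `𝕤_i = s_{2i} s_{2i-1} s_{2i+1} s_{2i} = (2i-1, 2i+1)(2i, 2i+2)`. -/
def bbs (n i : ℕ) : Equiv.Perm (Fin n) :=
  sGen n (2 * i) * sGen n (2 * i - 1) * sGen n (2 * i + 1) * sGen n (2 * i)

open scoped Classical in
/-- The set `𝔻_{(1,f-1)} = {𝕤_1 𝕤_2 ⋯ 𝕤_k : k = 0, …, f-1}` in `S_{2f}`. -/
noncomputable def bbD1 (f : ℕ) : Finset (Equiv.Perm (Fin (2 * f))) :=
  (Finset.range f).image (fun k => ((List.range k).map (fun j => bbs (2 * f) (j + 1))).prod)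

open scoped Classical in
/-- The set `𝔻_{(1,f-2)}^{{2,…,f}} = {𝕤_2 𝕤_3 ⋯ 𝕤_k : k = 1, …, f-1}` in `S_{2f}`. -/
noncomputable def bbD1' (f : ℕ) : Finset (Equiv.Perm (Fin (2 * f))) :=
  (Finset.Icc 1 (f - 1)).image
    (fun k => ((List.range (k - 1)).map (fun j => bbs (2 * f) (j + 2))).prod)

open scoped Classical in
/-- `H_f^{(a)} = {d ∈ H_f(n) : (1)d⁻¹ = 1, (2)d⁻¹ = 2}`. -/
noncomputable def HsetA (n f : ℕ) : Finset (Equiv.Perm (Fin n)) :=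
  (Hset n f).filter (fun d => pimg d⁻¹ 1 = 1 ∧ pimg d⁻¹ 2 = 2)

open scoped Classical in
/-- `H_f^{(b)} = {d ∈ H_f(n) : (1)d⁻¹ = 1, (2)d⁻¹ = 3}`. -/
noncomputable def HsetB (n f : ℕ) : Finset (Equiv.Perm (Fin n)) :=
  (Hset n f).filter (fun d => pimg d⁻¹ 1 = 1 ∧ pimg d⁻¹ 2 = 3)

open scoped Classical in
/-- `H_f^{(c)} = {d ∈ H_f(n) : (1)d⁻¹ = 1, (2)d⁻¹ = 2f+1}`. -/
noncomputable def HsetC (n f : ℕ) : Finset (Equiv.Perm (Fin n)) :=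
  (Hset n f).filter (fun d => pimg d⁻¹ 1 = 1 ∧ pimg d⁻¹ 2 = 2 * f + 1)

open scoped Classical in
/-- `H_f^{(d)} = {d ∈ H_f(n) : (1)d⁻¹ = 2f+1, (2)d⁻¹ = 1}`. -/
noncomputable def HsetD (n f : ℕ) : Finset (Equiv.Perm (Fin n)) :=
  (Hset n f).filter (fun d => pimg d⁻¹ 1 = 2 * f + 1 ∧ pimg d⁻¹ 2 = 1)

open scoped Classical in
/-- `H_f^{(e)} = {d ∈ H_f(n) : (1)d⁻¹ = 2f+1, (2)d⁻¹ = 2f+2}`. -/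
noncomputable def HsetE (n f : ℕ) : Finset (Equiv.Perm (Fin n)) :=
  (Hset n f).filter (fun d => pimg d⁻¹ 1 = 2 * f + 1 ∧ pimg d⁻¹ 2 = 2 * f + 2)

section Algebra

variable {F : Type*} [Field F] {A : Type*} [Ring A] [Algebra F A]

/-- For a set `S` of permutations, `hat c Tw S = Σ_{w ∈ S} c^{ℓ(w)} T_w`. -/
noncomputable def hat {n : ℕ} (c : F) (Tw : Equiv.Perm (Fin n) → A)
    (S : Finset (Equiv.Perm (Fin n))) : A :=
  ∑ w ∈ S, c ^ len w • Tw w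

/-- `Ehat E f = E_1 E_3 ⋯ E_{2f-1}`. -/
def Ehat (E : ℕ → A) (f : ℕ) : A := ((List.range f).map (fun i => E (2 * i + 1))).prod

/-- `Tprod T a b = T_a T_{a+1} ⋯ T_b` (the empty product `1` if `b < a`). -/
def Tprod (T : ℕ → A) (a b : ℕ) : A := ((List.range (b + 1 - a)).map (fun t => T (a + t))).prod

/-- `sDesc n a b = s_a s_{a-1} ⋯ s_b` (descending product of adjacent transpositions). -/
def sDesc (n a b : ℕ) : Equiv.Perm (Fin n) :=
  ((List.range (a + 1 - b)).map (fun j => sGen n (a - j))).prod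

/-- The data of a Birman–Murakami–Wenzl algebra structure: an `F`-algebra `A`
with invertible elements `T_1, …, T_{n-1}` and elements `E_1, …, E_{n-1}`
satisfying the BMW relations, together with a map `w ↦ T_w` from `S_n` to `A`
with `T_id = 1`, `T_{s_i} = T_i` and `T_{uv} = T_u T_v` whenever lengths add. -/
structure BMWData (F : Type*) [Field F] (A : Type*) [Ring A] [Algebra F A]
    (n : ℕ) (q r : F) where
  T : ℕ → A
  Tinv : ℕ → A
  E : ℕ → A
  Tw : Equiv.Perm (Fin n) → A
  hq : q ≠ 0
  hr : r ≠ 0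
  hqq : q - q⁻¹ ≠ 0
  T_mul_Tinv : ∀ i, 1 ≤ i → i ≤ n - 1 → T i * Tinv i = 1
  Tinv_mul_T : ∀ i, 1 ≤ i → i ≤ n - 1 → Tinv i * T i = 1
  skein : ∀ i, 1 ≤ i → i ≤ n - 1 → T i - Tinv i = (q - q⁻¹) • (1 - E i)
  Esq : ∀ i, 1 ≤ i → i ≤ n - 1 → E i * E i = (1 + (r - r⁻¹) / (q - q⁻¹)) • E i
  braid : ∀ i, 1 ≤ i → i + 1 ≤ n - 1 → T i * T (i + 1) * T i = T (i + 1) * T i * T (i + 1)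
  T_comm : ∀ i j, 1 ≤ i → i ≤ n - 1 → 1 ≤ j → j ≤ n - 1 → (i + 1 < j ∨ j + 1 < i) →
    T i * T j = T j * T i
  EEE₁ : ∀ i, 1 ≤ i → i + 1 ≤ n - 1 → E i * E (i + 1) * E i = E i
  EEE₂ : ∀ i, 1 ≤ i → i + 1 ≤ n - 1 → E (i + 1) * E i * E (i + 1) = E (i + 1)
  TTE₁ : ∀ i, 1 ≤ i → i + 1 ≤ n - 1 → T i * T (i + 1) * E i = E (i + 1) * E i
  TTE₂ : ∀ i, 1 ≤ i → i + 1 ≤ n - 1 → T (i + 1) * T i * E (i + 1) = E i * E (i + 1)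
  ET : ∀ i, 1 ≤ i → i ≤ n - 1 → E i * T i = r⁻¹ • E i
  TE : ∀ i, 1 ≤ i → i ≤ n - 1 → T i * E i = r⁻¹ • E i
  ETE₁ : ∀ i, 1 ≤ i → i + 1 ≤ n - 1 → E i * T (i + 1) * E i = r • E i
  ETE₂ : ∀ i, 1 ≤ i → i + 1 ≤ n - 1 → E (i + 1) * T i * E (i + 1) = r • E (i + 1)
  Tw_one : Tw 1 = 1
  Tw_s : ∀ i, 1 ≤ i → i ≤ n - 1 → Tw (sGen n i) = T i
  Tw_mul : ∀ u v : Equiv.Perm (Fin n), len (u * v) = len u + len v →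
    Tw (u * v) = Tw u * Tw v

/-- The scalars `a_f` defined by `a_0 = 1` and `a_i = a_{i-1} · Σ_{k=0}^{i-1} q^{2k}`. -/
noncomputable def aseq (q : F) : ℕ → F
  | 0 => 1
  | (i + 1) => aseq q i * (∑ k ∈ Finset.range (i + 1), q ^ (2 * k))


/-- The scalars `c_f` defined by `c_0 = 1` and
`c_f = -((q^{4f-3} - q^{2f-3})/(r q^{2n-2f-2} - q⁻¹)) · c_{f-1}`. -/
noncomputable def cseq (q r : F) (n : ℕ) : ℕ → F
  | 0 => 1
  | (f + 1) =>
      -((q ^ (4 * ((f : ℤ) + 1) - 3) - q ^ (2 * ((f : ℤ) + 1) - 3)) /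
          (r * q ^ (2 * (n : ℤ) - 2 * ((f : ℤ) + 1) - 2) - q⁻¹)) * cseq q r n f

/-- The scalars `č_f` defined by `č_0 = 1` and
`č_f = (q^{3-4f}(1 - q^{2f})/(q + r q^{2+2f-2n})) · č_{f-1}` (with integer exponents). -/
noncomputable def ccseq (q r : F) (n : ℕ) : ℕ → F
  | 0 => 1
  | (f + 1) =>
      (q ^ ((3 : ℤ) - 4 * ((f : ℤ) + 1)) * (1 - q ^ (2 * (f + 1))) /
          (q + r * q ^ ((2 : ℤ) + 2 * ((f : ℤ) + 1) - 2 * (n : ℤ)))) * ccseq q r n f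

/-- The element `x_f = (H_f⁻¹)^ · Ŝ_{{2f+1,…,n}} · Ê_f · Ĥ_f` of the BMW algebra. -/
noncomputable def xEl {F : Type*} [Field F] {A : Type*} [Ring A] [Algebra F A]
    {n : ℕ} {q r : F} (D : BMWData F A n q r) (f : ℕ) : A :=
  hat q D.Tw ((Hset n f).image (fun d => d⁻¹)) * hat q D.Tw (fixSet n (2 * f)) *
    Ehat D.E f * hat q D.Tw (Hset n f)

/-- The element `x̌_f = (H_f⁻¹)ˇ · Š_{{2f+1,…,n}} · Ê_f · Ȟ_f` of the BMW algebra,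
where `ˇ` is formed with `-q⁻¹` in place of `q`. -/
noncomputable def xElCheck {F : Type*} [Field F] {A : Type*} [Ring A] [Algebra F A]
    {n : ℕ} {q r : F} (D : BMWData F A n q r) (f : ℕ) : A :=
  hat (-q⁻¹) D.Tw ((Hset n f).image (fun d => d⁻¹)) * hat (-q⁻¹) D.Tw (fixSet n (2 * f)) *
    Ehat D.E f * hat (-q⁻¹) D.Tw (Hset n f)

end Algebra

section Length

variable {n : ℕ}

/-- If `u` preserves the blocks of a monotone block function and `v⁻¹` is increasing on blocks,
then lengths add. -/
theorem len_mul_of_blocks (B : Fin n → ℕ) (hB : Monotone B) (u v : Equiv.Perm (Fin n))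
    (hu : ∀ a, B (u a) = B a) (hv : ∀ x y, x < y → B x = B y → v⁻¹ x < v⁻¹ y) :
    len (u * v) = len u + len v := by
  have hv' : ∀ i j, i < j → B (v i) = B (v j) → v i < v j := by
    intro i j hij h
    by_contra hc
    rcases (not_lt.mp hc).lt_or_eq with h1 | h1
    · have := hv _ _ h1 h.symm
      exact absurd hij (by simpa using this.le)
    · exact hij.ne' (v.injective h1)
  have hlt : ∀ x y, B x < B y → x < y := fun x y h => hB.reflect_lt h
  have hu' : ∀ x y, x < y → u y < u x → B x = B y := by
    intro x y h1 h2
    have a1 := hB h1.le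
    have a2 := hB h2.le
    rw [hu, hu] at a2
    exact le_antisymm a1 a2
  unfold len
  rw [← Finset.card_map (s := Finset.univ.filter fun p : Fin n × Fin n => p.1 < p.2 ∧ u p.2 < u p.1)
    (Equiv.prodCongr v⁻¹ v⁻¹).toEmbedding, ← Finset.card_union_of_disjoint]
  · congr 1
    ext ⟨i, j⟩
    simp only [Finset.mem_filter, Finset.mem_univ, true_and, Finset.mem_union, Finset.mem_map,
      Equiv.coe_toEmbedding, Prod.exists, Equiv.prodCongr_apply, Prod.map_apply, Prod.mk.injEq]
    simp only [Equiv.Perm.mul_apply]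
    constructor
    · rintro ⟨hij, h⟩
      rcases lt_trichotomy (B (v i)) (B (v j)) with hb | hb | hb
      · have := hlt (u (v i)) (u (v j)) (by rwa [hu, hu])
        exact absurd h this.not_gt
      · exact Or.inl ⟨v i, v j, ⟨hv' i j hij hb, h⟩, by simp, by simp⟩
      · exact Or.inr ⟨hij, hlt _ _ hb⟩
    · rintro (⟨x, y, ⟨hxy, h⟩, rfl, rfl⟩ | ⟨hij, h⟩)
      · exact ⟨hv x y hxy (hu' x y hxy h), by simpa using h⟩
      · refine ⟨hij, hlt _ _ ?_⟩
        rw [hu, hu]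
        refine lt_of_le_of_ne (hB h.le) fun he => ?_
        exact absurd h (hv' i j hij he.symm).not_gt
  · rw [Finset.disjoint_left]
    rintro ⟨i, j⟩
    simp only [Finset.mem_filter, Finset.mem_univ, true_and, Finset.mem_map,
      Equiv.coe_toEmbedding, Prod.exists, Equiv.prodCongr_apply, Prod.map_apply, Prod.mk.injEq]
    rintro ⟨x, y, ⟨hxy, h⟩, rfl, rfl⟩ ⟨-, h2⟩
    exact absurd hxy (by simpa using h2.le)

theorem eq_one_of_len_eq_zero (w : Equiv.Perm (Fin n)) (h : len w = 0) : w = 1 := by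
  have hm : StrictMono w := by
    intro a b hab
    rw [len, Finset.card_eq_zero, Finset.filter_eq_empty_iff] at h
    have := h (Finset.mem_univ (a, b))
    simp only [not_and, not_lt] at this
    exact lt_of_le_of_ne (this hab) (fun h' => hab.ne (w.injective h'))
  ext a
  have := Subsingleton.elim (hm.orderIsoOfSurjective w w.surjective) (OrderIso.refl _)
  have h2 := DFunLike.congr_fun this a
  simpa using congrArg Fin.val h2

theorem blockOf_mono (μ : List ℕ) : Monotone (blockOf μ) := by
  intro a b hab
  unfold blockOf
  apply List.Sublist.length_le
  apply List.monotone_filter_right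
  intro j
  simp only [decide_eq_true_eq]
  omega

theorem mem_youngSet {μ : List ℕ} {w : Equiv.Perm (Fin n)} :
    w ∈ youngSet n μ ↔ ∀ a : Fin n, blockOf μ (w a) = blockOf μ a := by
  simp [youngSet]

theorem mul_mem_youngSet {μ : List ℕ} {u w : Equiv.Perm (Fin n)} (hu : u ∈ youngSet n μ)
    (hw : w ∈ youngSet n μ) : u * w ∈ youngSet n μ := by
  rw [mem_youngSet] at *
  intro a
  rw [Equiv.Perm.mul_apply, hu, hw]

theorem inv_mem_youngSet {μ : List ℕ} {w : Equiv.Perm (Fin n)} (hw : w ∈ youngSet n μ) :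
    w⁻¹ ∈ youngSet n μ := by
  rw [mem_youngSet] at *
  intro a
  simpa using (hw (w⁻¹ a)).symm

theorem inv_lt_inv_of_mem_Dset {μ : List ℕ} {d : Equiv.Perm (Fin n)} (hd : d ∈ Dset n μ)
    (a : ℕ) (h : a + 1 < n) (hb : blockOf μ a = blockOf μ (a + 1)) :
    d⁻¹ ⟨a, by omega⟩ < d⁻¹ ⟨a + 1, h⟩ := by
  by_contra hc
  set x : Fin n := ⟨a, by omega⟩ with hx
  set y : Fin n := ⟨a + 1, h⟩ with hy
  have hxy : x ≠ y := by simp [hx, hy]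
  have hlt : d⁻¹ y < d⁻¹ x :=
    lt_of_le_of_ne (not_lt.mp hc) fun h' => hxy (d⁻¹.injective h').symm
  let s : Equiv.Perm (Fin n) := Equiv.swap x y
  have hss : s * s = 1 := Equiv.swap_mul_self x y
  have hs : s ∈ youngSet n μ := by
    rw [mem_youngSet]
    intro c
    simp only [s, Equiv.swap_apply_def]
    split_ifs with h1 h2
    · rw [h1]; exact hb.symm
    · rw [h2]; exact hb
    · rfl
  let B : Fin n → ℕ := fun c => if (c : ℕ) ≤ a then c else c - 1
  have hB : Monotone B := by
    intro c e hce
    have : (c : ℕ) ≤ e := hce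
    simp only [B]
    split_ifs <;> omega
  have key := len_mul_of_blocks B hB s (s * d) (by
      intro c
      simp only [s, Equiv.swap_apply_def]
      split_ifs with h1 h2
      · simp [B, h1, hx, hy]
      · simp [B, h2, hx, hy]
      · rfl) (by
      intro c e hce hBe
      have hce' : (c : ℕ) < e := hce
      have h1 : (c : ℕ) = a ∧ (e : ℕ) = a + 1 := by
        simp only [B] at hBe
        split_ifs at hBe <;> omega
      have hc' : c = x := Fin.ext h1.1
      have he' : e = y := Fin.ext h1.2
      subst hc' he'
      simpa [s] using hlt)
  rw [← mul_assoc, hss, one_mul] at key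
  have hmin : len d ≤ len (s * d) :=
    (Finset.mem_filter.mp hd).2 s hs
  have h0 : s = 1 := eq_one_of_len_eq_zero s (by omega)
  exact hxy (Equiv.swap_eq_one_iff.mp h0)

theorem mem_Dset_iff {μ : List ℕ} {d : Equiv.Perm (Fin n)} :
    d ∈ Dset n μ ↔
      ∀ x y : Fin n, x < y → blockOf μ x = blockOf μ y → d⁻¹ x < d⁻¹ y := by
  constructor
  · intro hd x y hxy hb
    obtain ⟨x, hx⟩ := x
    obtain ⟨y, hy⟩ := y
    simp only [Fin.mk_lt_mk] at hxy hb
    induction y, hxy using Nat.le_induction with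
    | base => exact inv_lt_inv_of_mem_Dset hd x hy hb
    | succ y hxy ih =>
      have m1 := blockOf_mono μ (show x ≤ y by omega)
      have m2 := blockOf_mono μ (show y ≤ y + 1 by omega)
      exact (ih (by omega) (by omega)).trans
        (inv_lt_inv_of_mem_Dset hd y hy (by omega))
  · intro h
    refine Finset.mem_filter.mpr ⟨Finset.mem_univ _, fun u hu => ?_⟩
    rw [len_mul_of_blocks (fun a => blockOf μ a) (fun _ _ h => blockOf_mono μ h) u d
      (mem_youngSet.mp hu) h]
    omega

theorem len_mul_of_mem {μ : List ℕ} {u v : Equiv.Perm (Fin n)} (hu : u ∈ youngSet n μ)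
    (hv : v ∈ Dset n μ) : len (u * v) = len u + len v :=
  len_mul_of_blocks (fun a => blockOf μ a) (fun _ _ h => blockOf_mono μ h) u v
    (mem_youngSet.mp hu) (mem_Dset_iff.mp hv)

theorem exists_youngSet_mul_Dset (μ : List ℕ) (d : Equiv.Perm (Fin n)) :
    ∃ u ∈ youngSet n μ, ∃ v ∈ Dset n μ, d = u * v := by
  obtain ⟨w, hw, hmin⟩ := Finset.exists_min_image (youngSet n μ) (fun w => len (w * d))
    ⟨1, by simp [mem_youngSet]⟩
  refine ⟨w⁻¹, inv_mem_youngSet hw, w * d, ?_, by simp⟩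
  refine Finset.mem_filter.mpr ⟨Finset.mem_univ _, fun u hu => ?_⟩
  rw [← mul_assoc]
  exact hmin _ (mul_mem_youngSet hu hw)

theorem youngSet_mul_Dset_unique {μ : List ℕ} {u u' v v' : Equiv.Perm (Fin n)}
    (hu : u ∈ youngSet n μ) (hu' : u' ∈ youngSet n μ) (hv : v ∈ Dset n μ) (hv' : v' ∈ Dset n μ)
    (h : u * v = u' * v') : u = u' ∧ v = v' := by
  have e1 : v' = (u'⁻¹ * u) * v := by rw [mul_assoc, h, inv_mul_cancel_left]
  have e2 : v = (u⁻¹ * u') * v' := by rw [mul_assoc, ← h, inv_mul_cancel_left]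
  have l1 := len_mul_of_mem (mul_mem_youngSet (inv_mem_youngSet hu') hu) hv
  have l2 := len_mul_of_mem (mul_mem_youngSet (inv_mem_youngSet hu) hu') hv'
  rw [← e1] at l1
  rw [← e2] at l2
  have h1 := eq_one_of_len_eq_zero (u'⁻¹ * u) (by omega)
  refine ⟨(inv_mul_eq_one.mp h1).symm, ?_⟩
  rw [e1, h1, one_mul]

end Length

section Images

variable {n : ℕ}

theorem pimg_of_lt (d : Equiv.Perm (Fin n)) {i : ℕ} (h : i - 1 < n) :
    pimg d i = (d⁻¹ ⟨i - 1, h⟩ : Fin n) + 1 := by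
  simp [pimg, h]

theorem pimg_bounds (d : Equiv.Perm (Fin n)) {i : ℕ} (h1 : 1 ≤ i) (h2 : i ≤ n) :
    1 ≤ pimg d i ∧ pimg d i ≤ n := by
  rw [pimg_of_lt d (by omega)]
  omega

theorem pimg_mul (c d : Equiv.Perm (Fin n)) {i : ℕ} (h1 : 1 ≤ i) (h2 : i ≤ n) :
    pimg (c * d) i = pimg d (pimg c i) := by
  rw [pimg_of_lt (c * d) (by omega), pimg_of_lt c (by omega), pimg_of_lt d (by simp)]
  simp [mul_inv_rev]

theorem pimg_one {i : ℕ} (h1 : 1 ≤ i) (h2 : i ≤ n) : pimg (1 : Equiv.Perm (Fin n)) i = i := by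
  rw [pimg_of_lt _ (by omega)]
  simp
  omega

theorem pimg_injective (d : Equiv.Perm (Fin n)) {i j : ℕ} (hi : 1 ≤ i) (hi' : i ≤ n)
    (hj : 1 ≤ j) (hj' : j ≤ n) (h : pimg d i = pimg d j) : i = j := by
  rw [pimg_of_lt d (by omega), pimg_of_lt d (by omega)] at h
  have := d⁻¹.injective (Fin.ext (Nat.succ_injective h))
  simp only [Fin.mk.injEq] at this
  omega

theorem mem_Dset_iff_pimg {μ : List ℕ} {d : Equiv.Perm (Fin n)} :
    d ∈ Dset n μ ↔ ∀ a b, 1 ≤ a → a < b → b ≤ n → blockOf μ (a - 1) = blockOf μ (b - 1) →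
      pimg d a < pimg d b := by
  rw [mem_Dset_iff]
  constructor
  · intro h a b h1 h2 h3 h4
    rw [pimg_of_lt d (by omega), pimg_of_lt d (by omega)]
    have := h ⟨a - 1, by omega⟩ ⟨b - 1, by omega⟩ (by simp; omega) h4
    exact Nat.succ_lt_succ this
  · intro h x y hxy hb
    have := h (x + 1) (y + 1) (by omega) (by simpa using hxy) (by omega) (by simpa using hb)
    rw [pimg_of_lt d (by omega), pimg_of_lt d (by omega)] at this
    exact Nat.lt_of_succ_lt_succ this

theorem blockOf_replicate_two {f k : ℕ} (hk : k < 2 * f) :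
    blockOf (List.replicate f 2) k = k / 2 := by
  unfold blockOf
  rw [List.length_replicate]
  have : ∀ m ≤ f, ((List.range m).filter
      (fun j => decide (((List.replicate f 2).take (j + 1)).sum ≤ k))).length = min m (k / 2) := by
    intro m hm
    induction m with
    | zero => simp
    | succ m ih =>
      rw [List.range_succ, List.filter_append, List.length_append, ih (by omega)]
      simp only [List.take_replicate, List.sum_replicate, smul_eq_mul, List.filter_singleton]
      rw [min_eq_left hm]
      by_cases h : (m + 1) * 2 ≤ k
      · simp [h]; omega
      · simp [h]; omega
  rw [this f le_rfl]
  omega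

theorem blockOf_two_cons {m k : ℕ} (hk : k < 2 + m) :
    blockOf [2, m] k = if k < 2 then 0 else 1 := by
  have h2 : ¬ (2 + m ≤ k) := by omega
  by_cases h : k < 2
  · simp [blockOf, List.range_succ, h2, h]
  · have : 2 ≤ k := by omega
    simp [blockOf, List.range_succ, h2, h, this]

theorem mem_Dset_replicate_two {f : ℕ} {d : Equiv.Perm (Fin (2 * f))} :
    d ∈ Dset (2 * f) (List.replicate f 2) ↔
      ∀ i, 1 ≤ i → i ≤ f → pimg d (2 * i - 1) < pimg d (2 * i) := by
  rw [mem_Dset_iff_pimg]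
  constructor
  · intro h i h1 h2
    refine h _ _ (by omega) (by omega) (by omega) ?_
    rw [blockOf_replicate_two (by omega), blockOf_replicate_two (by omega)]
    omega
  · intro h a b h1 h2 h3 h4
    rw [blockOf_replicate_two (by omega), blockOf_replicate_two (by omega)] at h4
    have := h (b / 2) (by omega) (by omega)
    rwa [show 2 * (b / 2) - 1 = a by omega, show 2 * (b / 2) = b by omega] at this

theorem mem_Dset_two_cons {f : ℕ} (hf : 1 ≤ f) {d : Equiv.Perm (Fin (2 * f))} :
    d ∈ Dset (2 * f) [2, 2 * f - 2] ↔
      pimg d 1 < pimg d 2 ∧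
        ∀ a b, 3 ≤ a → a < b → b ≤ 2 * f → pimg d a < pimg d b := by
  rw [mem_Dset_iff_pimg]
  constructor
  · intro h
    refine ⟨h 1 2 (by omega) (by omega) (by omega) ?_, fun a b h1 h2 h3 => ?_⟩
    · rw [blockOf_two_cons (by omega), blockOf_two_cons (by omega)]
      simp
    · refine h a b (by omega) h2 h3 ?_
      rw [blockOf_two_cons (by omega), blockOf_two_cons (by omega), if_neg (by omega),
        if_neg (by omega)]
  · rintro ⟨h, h'⟩ a b h1 h2 h3 h4
    rw [blockOf_two_cons (by omega), blockOf_two_cons (by omega)] at h4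
    by_cases hb : b - 1 < 2
    · rwa [show a = 1 by omega, show b = 2 by omega]
    · rw [if_neg hb] at h4
      have ha : ¬ a - 1 < 2 := fun h => by simp [h] at h4
      exact h' a b (by omega) h2 h3

theorem mem_youngSet_two_cons_of_pimg {f : ℕ} {u : Equiv.Perm (Fin (2 * f))}
    (h1 : pimg u 1 = 1) (h2 : pimg u 2 = 2) : u ∈ youngSet (2 * f) [2, 2 * f - 2] := by
  rw [← inv_inv u]
  apply inv_mem_youngSet
  rw [mem_youngSet]
  intro a
  have ha := a.isLt
  have hb := (u⁻¹ a).isLt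
  rw [blockOf_two_cons (by omega), blockOf_two_cons (by omega)]
  have e : ((u⁻¹ a : Fin _) : ℕ) + 1 = pimg u (a + 1) := by
    rw [pimg_of_lt u (by omega)]
    simp
  have i1 := pimg_injective u (i := a + 1) (j := 1) (by omega) (by omega) (by omega) (by omega)
  have i2 := pimg_injective u (i := a + 1) (j := 2) (by omega) (by omega) (by omega) (by omega)
  have i3 : (a : ℕ) = 0 → pimg u (a + 1) = 1 := fun h => by rw [h, h1]
  have i4 : (a : ℕ) = 1 → pimg u (a + 1) = 2 := fun h => by rw [h, h2]
  congr 1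
  rw [eq_iff_iff]
  constructor
  · intro h
    have : pimg u (a + 1) = 1 ∨ pimg u (a + 1) = 2 := by omega
    rcases this with h' | h'
    · have := i1 (by rw [h', h1]); omega
    · have := i2 (by rw [h', h2]); omega
  · intro h
    have : (a : ℕ) = 0 ∨ (a : ℕ) = 1 := by omega
    rcases this with h' | h'
    · have := i3 h'; omega
    · have := i4 h'; omega

theorem pimg_le_two_of_mem_youngSet {f : ℕ} {u : Equiv.Perm (Fin (2 * f))}
    (hu : u ∈ youngSet (2 * f) [2, 2 * f - 2]) {a : ℕ} (h1 : 1 ≤ a) (h2 : a ≤ 2 * f) :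
    pimg u a ≤ 2 ↔ a ≤ 2 := by
  have := mem_youngSet.mp (inv_mem_youngSet hu) ⟨a - 1, by omega⟩
  rw [blockOf_two_cons (by omega), blockOf_two_cons (by simp; omega)] at this
  rw [pimg_of_lt u (by omega)]
  simp only at this
  split_ifs at this <;> omega

/-- The right action of the shifted embedding. -/
theorem pimg_shiftEmb {k m : ℕ} (h : k + m ≤ n) (w : Equiv.Perm (Fin m)) {i : ℕ} (h1 : 1 ≤ i)
    (h2 : i ≤ k + m) : pimg (shiftEmb n k m w) i = if i ≤ k then i else k + pimg w (i - k) := by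
  classical
  rw [pimg_of_lt _ (by omega), shiftEmb, dif_pos h, Equiv.Perm.extendDomain_inv]
  split_ifs with hi
  · rw [Equiv.Perm.extendDomain_apply_not_subtype
      (p := fun a : Fin n => k ≤ (a : ℕ) ∧ (a : ℕ) < k + m) _ _ (by simp; omega)]
    exact Nat.sub_add_cancel h1
  · rw [Equiv.Perm.extendDomain_apply_subtype
      (p := fun a : Fin n => k ≤ (a : ℕ) ∧ (a : ℕ) < k + m) _ _ (by simp; omega),
      pimg_of_lt w (by omega)]
    simp only [shiftEquiv, Equiv.coe_fn_mk, Equiv.coe_fn_symm_mk]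
    rw [add_assoc]
    congr 5
    omega

theorem exists_shiftEmb_eq {k m : ℕ} (h : k + m = n) {u : Equiv.Perm (Fin n)}
    (hu : ∀ i, 1 ≤ i → i ≤ k → pimg u i = i) : ∃ w, shiftEmb n k m w = u := by
  classical
  have hfix : ∀ a : Fin n, (a : ℕ) < k → u a = a := by
    intro a ha
    have := hu (a + 1) (by omega) (by omega)
    rw [pimg_of_lt u (by omega)] at this
    have : u⁻¹ a = a := by
      apply Fin.ext
      simpa using this
    rw [← Equiv.Perm.eq_inv_iff_eq, this]
  have hp : ∀ a : Fin n, (k ≤ (u a : ℕ) ∧ (u a : ℕ) < k + m) ↔ (k ≤ (a : ℕ) ∧ (a : ℕ) < k + m) := by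
    intro a
    have e1 : (a : ℕ) < k → (u a : ℕ) = a := fun h => by rw [hfix a h]
    have e2 : (u a : ℕ) < k → u a = a := fun h => u.injective (hfix _ h)
    constructor
    · intro h'
      by_contra hc
      have := e1 (by omega)
      omega
    · intro h'
      by_contra hc
      have := congrArg Fin.val (e2 (by omega))
      omega
  refine ⟨(shiftEquiv n k m h.le).symm.permCongr (u.subtypePerm hp), ?_⟩
  rw [shiftEmb, dif_pos h.le]
  apply Equiv.ext
  intro a
  by_cases ha : k ≤ (a : ℕ) ∧ (a : ℕ) < k + m
  · rw [Equiv.Perm.extendDomain_apply_subtype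
      (p := fun a : Fin n => k ≤ (a : ℕ) ∧ (a : ℕ) < k + m) _ _ ha]
    simp [Equiv.permCongr_apply]
  · rw [Equiv.Perm.extendDomain_apply_not_subtype
      (p := fun a : Fin n => k ≤ (a : ℕ) ∧ (a : ℕ) < k + m) _ _ ha, hfix a (by omega)]

theorem mem_Hset_two_mul {f : ℕ} {d : Equiv.Perm (Fin (2 * f))} :
    d ∈ Hset (2 * f) f ↔
      (∀ i, 1 ≤ i → i + 1 ≤ f → pimg d (2 * i - 1) < pimg d (2 * i + 1)) ∧
      (∀ i, 1 ≤ i → i ≤ f → pimg d (2 * i - 1) < pimg d (2 * i)) := by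
  simp only [Hset, Finset.mem_filter, Finset.mem_univ, true_and, Finset.mem_Icc]
  constructor
  · rintro ⟨h1, h2, -⟩
    exact ⟨fun i a b => h1 i ⟨a, by omega⟩, fun i a b => h2 i ⟨a, b⟩⟩
  · rintro ⟨h1, h2⟩
    exact ⟨fun i a => h1 i a.1 (by omega), fun i a => h2 i a.1 a.2, fun j hj => by omega⟩

open scoped Classical in
theorem mem_image_shiftEmb {f : ℕ} (hf : 1 ≤ f) {u : Equiv.Perm (Fin (2 * f))} :
    u ∈ (Hset (2 * f - 2) (f - 1)).image (shiftEmb (2 * f) 2 (2 * f - 2)) ↔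
      pimg u 1 = 1 ∧ pimg u 2 = 2 ∧
      (∀ i, 2 ≤ i → i + 1 ≤ f → pimg u (2 * i - 1) < pimg u (2 * i + 1)) ∧
      (∀ i, 2 ≤ i → i ≤ f → pimg u (2 * i - 1) < pimg u (2 * i)) := by
  obtain ⟨g, rfl⟩ : ∃ g, f = g + 1 := ⟨f - 1, by omega⟩
  rw [Nat.add_sub_cancel]
  generalize hm : 2 * (g + 1) - 2 = m
  obtain rfl : m = 2 * g := by omega
  rw [Finset.mem_image]
  have hs : ∀ w : Equiv.Perm (Fin (2 * g)), ∀ i, 3 ≤ i → i ≤ 2 * g + 2 →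
      pimg (shiftEmb (2 * (g + 1)) 2 (2 * g) w) i = 2 + pimg w (i - 2) := by
    intro w i h1 h2
    rw [pimg_shiftEmb (by omega) w (by omega) (by omega), if_neg (by omega)]
  constructor
  · rintro ⟨w, hw, rfl⟩
    rw [mem_Hset_two_mul] at hw
    refine ⟨?_, ?_, fun i h1 h2 => ?_, fun i h1 h2 => ?_⟩
    · rw [pimg_shiftEmb (by omega) w (by omega) (by omega), if_pos (by omega)]
    · rw [pimg_shiftEmb (by omega) w (by omega) (by omega), if_pos (by omega)]
    · rw [hs w _ (by omega) (by omega), hs w _ (by omega) (by omega)]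
      have := hw.1 (i - 1) (by omega) (by omega)
      rw [show 2 * (i - 1) - 1 = 2 * i - 1 - 2 by omega,
        show 2 * (i - 1) + 1 = 2 * i + 1 - 2 by omega] at this
      omega
    · rw [hs w _ (by omega) (by omega), hs w _ (by omega) (by omega)]
      have := hw.2 (i - 1) (by omega) (by omega)
      rw [show 2 * (i - 1) - 1 = 2 * i - 1 - 2 by omega,
        show 2 * (i - 1) = 2 * i - 2 by omega] at this
      omega
  · rintro ⟨h1, h2, h3, h4⟩
    obtain ⟨w, rfl⟩ := exists_shiftEmb_eq (k := 2) (m := 2 * g) (by omega) (u := u) (by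
      intro i hi hi'
      obtain rfl | rfl : i = 1 ∨ i = 2 := by omega
      · exact h1
      · exact h2)
    refine ⟨w, mem_Hset_two_mul.mpr ⟨fun i a b => ?_, fun i a b => ?_⟩, rfl⟩
    · have := h3 (i + 1) (by omega) (by omega)
      rw [hs w _ (by omega) (by omega), hs w _ (by omega) (by omega),
        show 2 * (i + 1) - 1 - 2 = 2 * i - 1 by omega,
        show 2 * (i + 1) + 1 - 2 = 2 * i + 1 by omega] at this
      omega
    · have := h4 (i + 1) (by omega) (by omega)
      rw [hs w _ (by omega) (by omega), hs w _ (by omega) (by omega),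
        show 2 * (i + 1) - 1 - 2 = 2 * i - 1 by omega,
        show 2 * (i + 1) - 2 = 2 * i by omega] at this
      omega

theorem pimg_sGen {i a : ℕ} (hi : 1 ≤ i) (hi' : i < n) (h1 : 1 ≤ a) (h2 : a ≤ n) :
    pimg (sGen n i) a = if a = i then i + 1 else if a = i + 1 then i else a := by
  rw [pimg_of_lt _ (by omega), sGen, dif_pos ⟨hi, hi'⟩, Equiv.swap_inv, Equiv.swap_apply_def]
  simp only [Fin.mk.injEq]
  split_ifs <;> simp only [] <;> omega

theorem pimg_bbs {i a : ℕ} (hi : 1 ≤ i) (hi' : 2 * i + 2 ≤ n) (h1 : 1 ≤ a) (h2 : a ≤ n) :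
    pimg (bbs n i) a = if a = 2 * i - 1 ∨ a = 2 * i then a + 2
      else if a = 2 * i + 1 ∨ a = 2 * i + 2 then a - 2 else a := by
  have S : ∀ j b c, 1 ≤ j → j < n → 1 ≤ b → b ≤ n →
      (b = j ∧ c = j + 1 ∨ b = j + 1 ∧ c = j ∨ b ≠ j ∧ b ≠ j + 1 ∧ c = b) →
      pimg (sGen n j) b = c := by
    intro j b c h1 h2 h3 h4 h5
    rw [pimg_sGen h1 h2 h3 h4]
    split_ifs <;> omega
  have path : ∀ b c d e, (a = 2 * i ∧ b = 2 * i + 1 ∨ a = 2 * i + 1 ∧ b = 2 * i ∨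
        a ≠ 2 * i ∧ a ≠ 2 * i + 1 ∧ b = a) →
      (b = 2 * i - 1 ∧ c = 2 * i ∨ b = 2 * i ∧ c = 2 * i - 1 ∨
        b ≠ 2 * i - 1 ∧ b ≠ 2 * i ∧ c = b) →
      (c = 2 * i + 1 ∧ d = 2 * i + 2 ∨ c = 2 * i + 2 ∧ d = 2 * i + 1 ∨
        c ≠ 2 * i + 1 ∧ c ≠ 2 * i + 2 ∧ d = c) →
      (d = 2 * i ∧ e = 2 * i + 1 ∨ d = 2 * i + 1 ∧ e = 2 * i ∨
        d ≠ 2 * i ∧ d ≠ 2 * i + 1 ∧ e = d) → pimg (bbs n i) a = e := by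
    intro b c d e hb hc hd he
    unfold bbs
    rw [pimg_mul _ _ h1 h2, pimg_mul _ _ h1 h2, pimg_mul _ _ h1 h2,
      S (2 * i) a b (by omega) (by omega) (by omega) (by omega) (by omega),
      S (2 * i - 1) b c (by omega) (by omega) (by omega) (by omega) (by omega),
      S (2 * i + 1) c d (by omega) (by omega) (by omega) (by omega) (by omega),
      S (2 * i) d e (by omega) (by omega) (by omega) (by omega) (by omega)]
  split_ifs with h h'
  · rcases h with h | h
    · exact path (2 * i - 1) (2 * i) (2 * i) _ (by omega) (by omega) (by omega) (by omega)
    · exact path (2 * i + 1) (2 * i + 1) (2 * i + 2) _ (by omega) (by omega) (by omega) (by omega)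
  · rcases h' with h' | h'
    · exact path (2 * i) (2 * i - 1) (2 * i - 1) _ (by omega) (by omega) (by omega) (by omega)
    · exact path (2 * i + 2) (2 * i + 2) (2 * i + 1) _ (by omega) (by omega) (by omega) (by omega)
  · exact path a a a _ (by omega) (by omega) (by omega) (by omega)

/-- The right action of `𝕤_1 ⋯ 𝕤_k`: the first pair moves to position `k + 1`. -/
theorem pimg_prod_bbs {k a : ℕ} (hk : 2 * k + 2 ≤ n) (h1 : 1 ≤ a) (h2 : a ≤ n) :
    pimg ((List.range k).map (fun j => bbs n (j + 1))).prod a =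
      if a ≤ 2 then a + 2 * k else if a ≤ 2 * k + 2 then a - 2 else a := by
  induction k with
  | zero =>
    simp only [List.range_zero, List.map_nil, List.prod_nil]
    rw [pimg_one h1 h2]
    split_ifs <;> omega
  | succ k ih =>
    rw [List.range_succ, List.map_append, List.prod_append, pimg_mul _ _ h1 h2, ih (by omega)]
    simp only [List.map_cons, List.map_nil, List.prod_cons, List.prod_nil, mul_one]
    rw [pimg_bbs (by omega) (by omega) (by split_ifs <;> omega) (by split_ifs <;> omega)]
    split_ifs <;> omega

theorem pimg_prod_bbs_mul {k : ℕ} (hk : 2 * k + 2 ≤ n) {d h : Equiv.Perm (Fin n)}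
    (hd : ((List.range k).map (fun j => bbs n (j + 1))).prod * h = d) :
    (∀ a, 1 ≤ a → a ≤ 2 → pimg h (a + 2 * k) = pimg d a) ∧
    (∀ a, 1 ≤ a → a ≤ 2 * k → pimg h a = pimg d (a + 2)) ∧
    (∀ a, 2 * k + 2 < a → a ≤ n → pimg h a = pimg d a) := by
  subst hd
  refine ⟨fun a h1 h2 => ?_, fun a h1 h2 => ?_, fun a h1 h2 => ?_⟩
  · rw [pimg_mul _ _ (by omega) (by omega), pimg_prod_bbs hk (by omega) (by omega), if_pos h2]
  · rw [pimg_mul _ _ (by omega) (by omega), pimg_prod_bbs hk (by omega) (by omega),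
      if_neg (by omega), if_pos (by omega), Nat.add_sub_cancel]
  · rw [pimg_mul _ _ (by omega) (by omega), pimg_prod_bbs hk (by omega) (by omega),
      if_neg (by omega), if_neg (by omega)]

end Images

/-- Membership in `𝔻_{(1,f-1)} · H_f(2f)` in terms of the order of the images of the pairs. -/
theorem mem_bbD1_mul_Hset {f : ℕ} (hf : 1 ≤ f) {d : Equiv.Perm (Fin (2 * f))} :
    d ∈ bbD1 f * Hset (2 * f) f ↔
      (∀ i, 1 ≤ i → i ≤ f → pimg d (2 * i - 1) < pimg d (2 * i)) ∧
      (∀ i, 2 ≤ i → i + 1 ≤ f → pimg d (2 * i - 1) < pimg d (2 * i + 1)) := by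
  rw [Finset.mem_mul]
  constructor
  · rintro ⟨c, hc, h, hh, hd⟩
    obtain ⟨k, hk, rfl⟩ := Finset.mem_image.mp hc
    rw [Finset.mem_range] at hk
    obtain ⟨h1, h2⟩ := mem_Hset_two_mul.mp hh
    obtain ⟨kfirst, klow, khigh⟩ := pimg_prod_bbs_mul (by omega) hd
    refine ⟨fun i a b => ?_, fun i a b => ?_⟩
    · rcases (show i = 1 ∨ (1 < i ∧ i ≤ k + 1) ∨ k + 1 < i by omega) with rfl | hi | hi
      · have := h2 (k + 1) (by omega) (by omega)
        rw [show 2 * (k + 1) - 1 = 1 + 2 * k by omega, show 2 * (k + 1) = 2 + 2 * k by omega,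
          kfirst 1 (by omega) (by omega), kfirst 2 (by omega) (by omega)] at this
        exact this
      · have := h2 (i - 1) (by omega) (by omega)
        rw [klow _ (by omega) (by omega), klow _ (by omega) (by omega)] at this
        convert this using 2 <;> omega
      · rw [← khigh _ (by omega) (by omega), ← khigh _ (by omega) (by omega)]
        exact h2 i a b
    · rcases (show i + 1 ≤ k + 1 ∨ i = k + 1 ∨ k + 1 < i by omega) with hi | hi | hi
      · have := h1 (i - 1) (by omega) (by omega)
        rw [klow _ (by omega) (by omega), klow _ (by omega) (by omega)] at this
        convert this using 2 <;> omega
      · have := (h1 (i - 1) (by omega) (by omega)).trans_eq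
          (congrArg (pimg h) (show 2 * (i - 1) + 1 = 2 * i - 1 by omega))
        have := this.trans (h1 i (by omega) b)
        rw [klow _ (by omega) (by omega), khigh _ (by omega) (by omega)] at this
        rwa [show 2 * (i - 1) - 1 + 2 = 2 * i - 1 by omega] at this
      · rw [← khigh _ (by omega) (by omega), ← khigh _ (by omega) (by omega)]
        exact h1 i (by omega) b
  · rintro ⟨h1, h2⟩
    obtain ⟨k, hk, hlow, hhigh⟩ : ∃ k < f,
        (∀ i, 2 ≤ i → i ≤ k + 1 → pimg d (2 * i - 1) < pimg d 1) ∧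
        (k + 2 ≤ f → pimg d 1 < pimg d (2 * k + 3)) := by
      by_contra hc
      push Not at hc
      have : ∀ k < f, ∀ i, 2 ≤ i → i ≤ k + 1 → pimg d (2 * i - 1) < pimg d 1 := by
        intro k hk
        induction k with
        | zero => intro i _ _; omega
        | succ k ih =>
          intro i hi hi'
          have ih' := ih (by omega)
          rcases (show i ≤ k + 1 ∨ i = k + 2 by omega) with h | rfl
          · exact ih' i hi h
          · have := (hc k (by omega) ih').2
            rw [show 2 * (k + 2) - 1 = 2 * k + 3 by omega]
            refine lt_of_le_of_ne this fun he => ?_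
            have := pimg_injective d (by omega) (by omega) (by omega) (by omega) he
            omega
      have h3 := (hc (f - 1) (by omega) (this (f - 1) (by omega))).1
      omega
    set c := ((List.range k).map (fun j => bbs (2 * f) (j + 1))).prod
    refine ⟨c, Finset.mem_image.mpr ⟨k, Finset.mem_range.mpr hk, rfl⟩, c⁻¹ * d, ?_, by simp⟩
    obtain ⟨kfirst, klow, khigh⟩ := pimg_prod_bbs_mul (by omega) (mul_inv_cancel_left c d)
    have kf1 := kfirst 1 (by omega) (by omega)
    have kf2 := kfirst 2 (by omega) (by omega)
    refine mem_Hset_two_mul.mpr ⟨fun i a b => ?_, fun i a b => ?_⟩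
    · rcases (show i + 1 ≤ k ∨ i = k ∨ i = k + 1 ∨ k + 1 < i by omega) with hi | hi | hi | hi
      · rw [klow _ (by omega) (by omega), klow _ (by omega) (by omega)]
        have := h2 (i + 1) (by omega) (by omega)
        convert this using 2 <;> omega
      · rw [klow _ (by omega) (by omega), show 2 * i + 1 = 1 + 2 * k by omega, kf1]
        have := hlow (i + 1) (by omega) (by omega)
        convert this using 2
        omega
      · rw [khigh (2 * i + 1) (by omega) (by omega), show 2 * i - 1 = 1 + 2 * k by omega, kf1]
        have := hhigh (by omega)
        convert this using 2
        omega
      · rw [khigh _ (by omega) (by omega), khigh _ (by omega) (by omega)]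
        exact h2 i (by omega) b
    · rcases (show i ≤ k ∨ i = k + 1 ∨ k + 1 < i by omega) with hi | hi | hi
      · rw [klow _ (by omega) (by omega), klow _ (by omega) (by omega)]
        have := h1 (i + 1) (by omega) (by omega)
        convert this using 2 <;> omega
      · rw [show 2 * i - 1 = 1 + 2 * k by omega, show 2 * i = 2 + 2 * k by omega, kf1, kf2]
        exact h1 1 (by omega) (by omega)
      · rw [khigh _ (by omega) (by omega), khigh _ (by omega) (by omega)]
        exact h1 i a b

open scoped Classical in
theorem mem_youngSet_of_mem_image_shiftEmb {f : ℕ} (hf : 1 ≤ f) {u : Equiv.Perm (Fin (2 * f))}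
    (hu : u ∈ (Hset (2 * f - 2) (f - 1)).image (shiftEmb (2 * f) 2 (2 * f - 2))) :
    u ∈ youngSet (2 * f) [2, 2 * f - 2] := by
  obtain ⟨h1, h2, -⟩ := (mem_image_shiftEmb hf).mp hu
  exact mem_youngSet_two_cons_of_pimg h1 h2

open scoped Classical in
theorem mem_bbD1_mul_Hset_iff_exists {f : ℕ} (hf : 1 ≤ f) {d : Equiv.Perm (Fin (2 * f))} :
    d ∈ bbD1 f * Hset (2 * f) f ↔
      ∃ u ∈ (Hset (2 * f - 2) (f - 1)).image (shiftEmb (2 * f) 2 (2 * f - 2)),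
        ∃ v ∈ Dset (2 * f) [2, 2 * f - 2], u * v = d := by
  rw [mem_bbD1_mul_Hset hf]
  constructor
  · rintro ⟨h1, h2⟩
    obtain ⟨u, hu, v, hv, rfl⟩ := exists_youngSet_mul_Dset [2, 2 * f - 2] d
    refine ⟨u, ?_, v, hv, rfl⟩
    have hle : ∀ a, 1 ≤ a → a ≤ 2 * f → (pimg u a ≤ 2 ↔ a ≤ 2) :=
      fun a ha hb => pimg_le_two_of_mem_youngSet hu ha hb
    rw [mem_Dset_two_cons hf] at hv
    have p1 := hle 1 (by omega) (by omega)
    have p2 := hle 2 (by omega) (by omega)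
    have b1 := pimg_bounds u (i := 1) (by omega) (by omega)
    have b2 := pimg_bounds u (i := 2) (by omega) (by omega)
    have hne : pimg u 1 ≠ pimg u 2 := fun h => by
      have := pimg_injective u (by omega) (by omega) (by omega) (by omega) h
      omega
    have hrefl : ∀ a b, 3 ≤ a → a ≤ 2 * f → 3 ≤ b → b ≤ 2 * f →
        pimg (u * v) a < pimg (u * v) b → pimg u a < pimg u b := by
      intro a b ha ha' hb hb' h
      rw [pimg_mul _ _ (by omega) ha', pimg_mul _ _ (by omega) hb'] at h
      by_contra hc
      have q := hle b (by omega) hb'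
      have r := pimg_bounds u (i := a) (by omega) ha'
      rcases (not_lt.mp hc).lt_or_eq with h' | h'
      · exact absurd h (hv.2 _ _ (by omega) h' r.2).not_gt
      · rw [h'] at h
        exact lt_irrefl _ h
    have h12 : ¬ (pimg u 1 = 2 ∧ pimg u 2 = 1) := by
      rintro ⟨e1, e2⟩
      have := h1 1 le_rfl hf
      rw [pimg_mul _ _ (by omega) (by omega), pimg_mul _ _ (by omega) (by omega)] at this
      simp only [Nat.mul_one, Nat.reduceSub, e1, e2] at this
      exact absurd this hv.1.not_gt
    refine (mem_image_shiftEmb hf).mpr ⟨by omega, by omega, fun i a b => ?_, fun i a b => ?_⟩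
    · exact hrefl _ _ (by omega) (by omega) (by omega) (by omega) (h2 i a b)
    · exact hrefl _ _ (by omega) (by omega) (by omega) (by omega) (h1 i (by omega) b)
  · rintro ⟨u, hu, v, hv, rfl⟩
    have hle : ∀ a, 1 ≤ a → a ≤ 2 * f → (pimg u a ≤ 2 ↔ a ≤ 2) :=
      fun a ha hb =>
        pimg_le_two_of_mem_youngSet (mem_youngSet_of_mem_image_shiftEmb hf hu) ha hb
    obtain ⟨u1, u2, u3, u4⟩ := (mem_image_shiftEmb hf).mp hu
    rw [mem_Dset_two_cons hf] at hv
    have hmono : ∀ a b, 3 ≤ a → a ≤ 2 * f → 3 ≤ b → b ≤ 2 * f →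
        pimg u a < pimg u b → pimg (u * v) a < pimg (u * v) b := by
      intro a b ha ha' hb hb' h
      rw [pimg_mul _ _ (by omega) ha', pimg_mul _ _ (by omega) hb']
      have q := hle a (by omega) ha'
      have r := pimg_bounds u (i := b) (by omega) hb'
      exact hv.2 _ _ (by omega) h r.2
    refine ⟨fun i a b => ?_, fun i a b => ?_⟩
    · rcases a.eq_or_lt with rfl | a'
      · rw [pimg_mul _ _ (by omega) (by omega), pimg_mul _ _ (by omega) (by omega)]
        simpa [u1, u2] using hv.1
      · exact hmono _ _ (by omega) (by omega) (by omega) (by omega) (u4 i a' b)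
    · exact hmono _ _ (by omega) (by omega) (by omega) (by omega) (u3 i a b)

open scoped Classical in
/-- For `f ≥ 1`, in `S_{2f}`:
`𝔻_{(1,f-1)} · H_f(2f) = H_{f-1}^{{3,…,2f}} · D_{(2,2f-2)}`, every element of this
set factors uniquely as `u·v` with lengths adding, and this set equals the set of
`d ∈ D_{(2,…,2)}` with `(3)d < (5)d < ⋯ < (2f-1)d`. -/
theorem statement9 (f : ℕ) (hf : 1 ≤ f) :
    bbD1 f * Hset (2 * f) f =
      ((Hset (2 * f - 2) (f - 1)).image (shiftEmb (2 * f) 2 (2 * f - 2))) *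
        Dset (2 * f) [2, 2 * f - 2] ∧
    (∀ d ∈ bbD1 f * Hset (2 * f) f,
      ∃! uv : Equiv.Perm (Fin (2 * f)) × Equiv.Perm (Fin (2 * f)),
        uv.1 ∈ (Hset (2 * f - 2) (f - 1)).image (shiftEmb (2 * f) 2 (2 * f - 2)) ∧
        uv.2 ∈ Dset (2 * f) [2, 2 * f - 2] ∧ d = uv.1 * uv.2 ∧
        len d = len uv.1 + len uv.2) ∧
    bbD1 f * Hset (2 * f) f =
      (Dset (2 * f) (List.replicate f 2)).filter
        (fun d => ∀ i ∈ Finset.Icc 1 (f - 2), pimg d (2 * i + 1) < pimg d (2 * i + 3)) := by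
  refine ⟨?_, fun d hd => ?_, ?_⟩
  · ext d
    rw [mem_bbD1_mul_Hset_iff_exists hf, Finset.mem_mul]
  · obtain ⟨u, hu, v, hv, rfl⟩ := (mem_bbD1_mul_Hset_iff_exists hf).mp hd
    have huy := mem_youngSet_of_mem_image_shiftEmb hf hu
    refine ⟨(u, v), ⟨hu, hv, rfl, len_mul_of_mem huy hv⟩, ?_⟩
    rintro ⟨u', v'⟩ ⟨hu', hv', h, -⟩
    obtain ⟨rfl, rfl⟩ := youngSet_mul_Dset_unique huy
      (mem_youngSet_of_mem_image_shiftEmb hf hu') hv hv' h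
    rfl
  · ext d
    rw [mem_bbD1_mul_Hset hf]
    simp only [Finset.mem_filter, mem_Dset_replicate_two]
    refine and_congr_right fun _ => ⟨fun h i hi => ?_, fun h i a b => ?_⟩
    · rw [Finset.mem_Icc] at hi
      have := h (i + 1) (by omega) (by omega)
      convert this using 2 <;> omega
    · have := h (i - 1) (Finset.mem_Icc.mpr ⟨by omega, by omega⟩)
      convert this using 2 <;> omega
end BMWPaper
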